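/- Let G=(V,E) be a finite graph, m≥1 an integer, p≥2, λ>0, h:V→(0,∞), f:V×ℝ→ℝ with s↦f(x,s) continuous for every x∈V, and F(x,s)=∫_0^s f(x,τ)dτ. Assume: (f2) there exist α∈[0,p) and g1,g2:V→ℝ with F(x,s) ≤ g1(x)|s|^α + g2(x) for all (x,s)∈V×ℝ; (f3) there exist γ,δ>0 with δ>γκ, where κ=((1/p)∫_V h dμ)^{−1/p}, such that Λ'1<Λ'2, where Λ'1 = γ^{−p}·(max{F(x,s) : x∈V, |s| ≤ (pγ^p)^{1/p}/(h_min^{1/p}·μ_min^{1/p})})·|V| and Λ'2 = (min_{x∈V}F(x,δ))·|V|/((δ^p/p)∫_V h dμ). Then for every λ>0 with λ·Λ'2>1 and λ·Λ'1<1, the equation 𝓛_{m,p}u + h|u|^{p−2}u = λf(x,u) has at least three pairwise distinct solutions u:V→ℝ. -/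

import Mathlib

open Real

noncomputable section

variable {V : Type*}

/-- Integral on a finite graph: `∫_V u dμ = ∑_{x∈V} μ(x) u(x)`. -/
def intV [Fintype V] (μ u : V → ℝ) : ℝ := ∑ x, μ x * u x

/-- Graph Laplacian. -/
def glap [Fintype V] (w : V → V → ℝ) (μ : V → ℝ) (u : V → ℝ) (x : V) : ℝ :=
  (1 / μ x) * ∑ y, w x y * (u y - u x)

/-- The bilinear form Γ. -/
def ggam [Fintype V] (w : V → V → ℝ) (μ : V → ℝ) (u v : V → ℝ) (x : V) : ℝ :=
  (1 / (2 * μ x)) * ∑ y, w x y * (u y - u x) * (v y - v x)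

/-- Length of the gradient: `|∇u|(x) = √(Γ(u,u)(x))`. -/
def gnorm [Fintype V] (w : V → V → ℝ) (μ : V → ℝ) (u : V → ℝ) (x : V) : ℝ :=
  Real.sqrt (ggam w μ u u x)

/-- The length `|∇^m u|` of the m-th order gradient. -/
def gradm [Fintype V] (w : V → V → ℝ) (μ : V → ℝ) (m : ℕ) (u : V → ℝ) (x : V) : ℝ :=
  if m % 2 = 1 then gnorm w μ ((glap w μ)^[(m - 1) / 2] u) x
  else |((glap w μ)^[m / 2] u) x|

/-- The Sobolev norm `‖u‖_{W^{m,l}}` (with weight `h`). -/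
def wnorm [Fintype V] (w : V → V → ℝ) (μ h : V → ℝ) (m : ℕ) (l : ℝ) (u : V → ℝ) : ℝ :=
  (intV μ (fun x => gradm w μ m u x ^ l + h x * |u x| ^ l)) ^ (1 / l)

/-- min of a function over the (nonempty finite) vertex set. -/
def fmin [Fintype V] [Nonempty V] (f : V → ℝ) : ℝ :=
  Finset.univ.inf' Finset.univ_nonempty f

/-- max of a function over the (nonempty finite) vertex set. -/
def fmax [Fintype V] [Nonempty V] (f : V → ℝ) : ℝ :=
  Finset.univ.sup' Finset.univ_nonempty f

/-- The poly-Laplacian pairing `B_{m,p}(u,φ)`. -/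
def Bmp [Fintype V] (w : V → V → ℝ) (μ : V → ℝ) (m : ℕ) (p : ℝ) (u φ : V → ℝ) : ℝ :=
  if m % 2 = 1 then
    intV μ (fun x => gradm w μ m u x ^ (p - 2) *
      ggam w μ ((glap w μ)^[(m - 1) / 2] u) ((glap w μ)^[(m - 1) / 2] φ) x)
  else
    intV μ (fun x => gradm w μ m u x ^ (p - 2) *
      ((glap w μ)^[m / 2] u x) * ((glap w μ)^[m / 2] φ x))

end

noncomputable section
variable {V : Type*}

/-- `u` is a (weak) solution of `𝓛_{m,p}u + h|u|^{p−2}u = λ f(x,u)` on a finite graph. -/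
def isSolScalar [Fintype V] (w : V → V → ℝ) (μ h : V → ℝ) (m : ℕ)
    (p lam : ℝ) (f : V → ℝ → ℝ) (u : V → ℝ) : Prop :=
  ∀ φ : V → ℝ,
    Bmp w μ m p u φ + intV μ (fun x => h x * |u x| ^ (p - 2) * u x * φ x) =
      lam * intV μ (fun x => f x (u x) * φ x)

end

section

open Filter Topology

/-- A coercive continuously differentiable function on `ℝ^ι` satisfying the mountain pass geometry
around two critical points `a`, `b` has a critical point at a level at least `ρ`. -/
theorem exists_mountain_pass {ι : Type*} [Fintype ι] {J : (ι → ℝ) → ℝ}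
    (hJ : ContDiff ℝ 1 J) (hco : Tendsto J (cocompact (ι → ℝ)) atTop)
    {a b : ι → ℝ} (ha : fderiv ℝ J a = 0) (hb : fderiv ℝ J b = 0) {ρ : ℝ}
    (hρ : ∀ A : Set (ι → ℝ), IsPreconnected A → a ∈ A → b ∈ A → ∃ u ∈ A, ρ ≤ J u) :
    ∃ u, fderiv ℝ J u = 0 ∧ ρ ≤ J u := by
  classical
  have hd : Differentiable ℝ J := hJ.differentiable one_ne_zero
  have hL : Continuous (fderiv ℝ J) := hJ.continuous_fderiv one_ne_zero
  let G : (ι → ℝ) → ι → ℝ := fun u i => fderiv ℝ J u (Pi.single i 1)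
  have hG : Continuous G := continuous_pi fun i => hL.clm_apply continuous_const
  have hLG : ∀ u v, fderiv ℝ J u v = ∑ i, v i * G u i := by
    intro u v
    conv_lhs => rw [pi_eq_sum_univ' v]
    simp [G]
  have hGG : ∀ u, ‖G u‖ ^ 2 ≤ fderiv ℝ J u (G u) := by
    intro u
    have h0 : 0 ≤ fderiv ℝ J u (G u) := by
      rw [hLG]; exact Finset.sum_nonneg fun i _ => mul_self_nonneg _
    rw [← Real.le_sqrt (norm_nonneg _) h0, pi_norm_le_iff_of_nonneg (Real.sqrt_nonneg _)]
    intro i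
    refine Real.le_sqrt_of_sq_le ?_
    rw [Real.norm_eq_abs, sq_abs, hLG, sq]
    exact Finset.single_le_sum (f := fun i => G u i * G u i)
      (fun i _ => mul_self_nonneg _) (Finset.mem_univ i)
  have hG0 : ∀ u, G u = 0 → fderiv ℝ J u = 0 := by
    intro u hu
    ext v
    simp [hLG, hu]
  let S : Set ℝ := {M | ∃ A : Set (ι → ℝ), IsPreconnected A ∧ a ∈ A ∧ b ∈ A ∧ ∀ u ∈ A, J u ≤ M}
  have hSne : S.Nonempty := by
    have hc : IsCompact (segment ℝ a b) := by
      rw [segment_eq_image_lineMap]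
      exact isCompact_Icc.image (AffineMap.lineMap_continuous)
    obtain ⟨M, hM⟩ := hc.bddAbove_image hd.continuous.continuousOn
    exact ⟨M, _, (convex_segment a b).isPreconnected, left_mem_segment ℝ a b,
      right_mem_segment ℝ a b, fun u hu => hM ⟨u, hu, rfl⟩⟩
  have hSlb : ∀ M ∈ S, ρ ≤ M := by
    rintro M ⟨A, hA, haA, hbA, hM⟩
    obtain ⟨u, hu, hu'⟩ := hρ A hA haA hbA
    exact hu'.trans (hM u hu)
  have hSbdd : BddBelow S := ⟨ρ, hSlb⟩
  set c := sInf S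
  by_contra! hcon
  have hpos : ∀ u, 0 < ‖G u‖ + |J u - c| := by
    intro u
    by_contra! hle
    have h1 : ‖G u‖ = 0 := by linarith [norm_nonneg (G u), abs_nonneg (J u - c)]
    have h2 : |J u - c| = 0 := by linarith [norm_nonneg (G u), abs_nonneg (J u - c)]
    have h3 := hcon u (hG0 u (norm_eq_zero.1 h1))
    have h4 := le_csInf hSne hSlb
    linarith [abs_eq_zero.1 h2]
  obtain ⟨K, hK, hKJ⟩ := mem_cocompact.1 (hco.eventually_gt_atTop (c + 1))
  have hKJ' : ∀ u, J u ≤ c + 1 → u ∈ K := by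
    intro u hu
    by_contra hn
    have : c + 1 < J u := hKJ hn
    linarith
  have haK : ∃ R > 0, K ⊆ Metric.closedBall 0 R := by
    obtain ⟨R, hR⟩ := hK.isBounded.subset_closedBall 0
    exact ⟨max R 1, by positivity, hR.trans (Metric.closedBall_subset_closedBall (le_max_left _ _))⟩
  obtain ⟨R, hR, hKR⟩ := haK
  have hB : IsCompact (Metric.closedBall (0 : ι → ℝ) (R + 1)) := isCompact_closedBall _ _
  have hBne : (Metric.closedBall (0 : ι → ℝ) (R + 1)).Nonempty := ⟨0, by simp; linarith⟩
  obtain ⟨σ, hσ, hσB⟩ : ∃ σ > 0, ∀ u ∈ Metric.closedBall (0 : ι → ℝ) (R + 1),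
      2 * σ ≤ ‖G u‖ + |J u - c| := by
    obtain ⟨u0, -, hu0⟩ := hB.exists_isMinOn hBne
      (f := fun u => ‖G u‖ + |J u - c|)
      (hG.norm.add (hd.continuous.sub continuous_const).abs).continuousOn
    refine ⟨(‖G u0‖ + |J u0 - c|) / 2, by linarith [hpos u0], fun u hu => ?_⟩
    have : ‖G u0‖ + |J u0 - c| ≤ ‖G u‖ + |J u - c| := hu0 hu
    linarith
  obtain ⟨D, hD, hDB⟩ : ∃ D > 0, ∀ u ∈ Metric.closedBall (0 : ι → ℝ) (R + 1), ‖G u‖ ≤ D := by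
    obtain ⟨D, hD⟩ := hB.bddAbove_image hG.norm.continuousOn
    exact ⟨max D 1, by positivity, fun u hu => (hD ⟨u, hu, rfl⟩).trans (le_max_left _ _)⟩
  obtain ⟨d, hd0, hdB⟩ := Metric.uniformContinuousOn_iff.1
    (hB.uniformContinuousOn_of_continuous hL.continuousOn) (σ / 2) (by positivity)
  obtain ⟨s, hs0, hsσ, hsD, hsd⟩ : ∃ s > 0, s * σ ≤ 1 ∧ s * D ≤ 1 ∧ s * D < d := by
    refine ⟨min (1 / σ) (min (1 / D) (d / (2 * D))), by positivity, ?_, ?_, ?_⟩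
    · rw [← le_div_iff₀ hσ]
      exact min_le_left _ _
    · rw [← le_div_iff₀ hD]
      exact (min_le_right _ _).trans (min_le_left _ _)
    · calc _ ≤ d / (2 * D) * D := by
            gcongr; exact (min_le_right _ _).trans (min_le_right _ _)
        _ = d / 2 := by field_simp
        _ < d := by linarith
  have step : ∀ u ∈ K, J (u - s • G u) ≤ J u - s * ‖G u‖ * (‖G u‖ - σ / 2) := by
    intro u hu
    have huR := hKR hu
    have huB : u ∈ Metric.closedBall (0 : ι → ℝ) (R + 1) :=
      Metric.closedBall_subset_closedBall (by linarith) huR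
    have hn : ‖s • G u‖ ≤ s * D := by
      rw [norm_smul, Real.norm_of_nonneg hs0.le]
      gcongr
      exact hDB u huB
    have hball : Metric.closedBall u (s * D) ⊆ Metric.closedBall (0 : ι → ℝ) (R + 1) := by
      refine Metric.closedBall_subset_closedBall' ?_
      have := Metric.mem_closedBall.1 huR
      linarith
    have hmv := (convex_closedBall u (s * D)).norm_image_sub_le_of_norm_hasFDerivWithin_le'
      (f := J) (f' := fderiv ℝ J) (φ := fderiv ℝ J u) (C := σ / 2) (x := u) (y := u - s • G u)
      (fun v _ => (hd v).hasFDerivAt.hasFDerivWithinAt)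
      (fun v hv => by
        rw [← dist_eq_norm]
        exact (hdB v (hball hv) u huB ((Metric.mem_closedBall.1 hv).trans_lt hsd)).le)
      (Metric.mem_closedBall_self (by positivity))
      (by rw [Metric.mem_closedBall, dist_eq_norm]; simpa using hn)
    have h1 := (abs_le.1 ((Real.norm_eq_abs _).symm.le.trans hmv)).2
    have h2 : fderiv ℝ J u (u - s • G u - u) = - (s * fderiv ℝ J u (G u)) := by
      rw [show u - s • G u - u = -(s • G u) by abel]
      simp
    have h3 : ‖u - s • G u - u‖ = s * ‖G u‖ := by
      rw [show u - s • G u - u = -(s • G u) by abel, norm_neg, norm_smul,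
        Real.norm_of_nonneg hs0.le]
    rw [h2, h3] at h1
    have h4 := mul_le_mul_of_nonneg_left (hGG u) hs0.le
    nlinarith
  obtain ⟨θ, hθ, hθ1, hθσ, hθs⟩ : ∃ θ > 0, θ ≤ 1 ∧ θ ≤ σ / 2 ∧ 2 * θ ≤ s * σ ^ 2 / 2 :=
    ⟨min (min 1 (σ / 2)) (s * σ ^ 2 / 4), by positivity,
      (min_le_left _ _).trans (min_le_left _ _), (min_le_left _ _).trans (min_le_right _ _),
      by linarith [min_le_right (min 1 (σ / 2)) (s * σ ^ 2 / 4)]⟩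
  have deform : ∀ u, J u ≤ c + θ → J (u - s • G u) ≤ c - θ := by
    intro u hu
    have huK := hKJ' u (by linarith)
    have h1 := step u huK
    have h2 := hσB u (Metric.closedBall_subset_closedBall (by linarith) (hKR huK))
    have hg := norm_nonneg (G u)
    rcases lt_or_ge ‖G u‖ σ with hlt | hge
    · have h3 : J u ≤ c - σ := by
        rcases abs_cases (J u - c) with ⟨h4, -⟩ | ⟨h4, -⟩ <;> linarith
      have h5 : -(‖G u‖ * (‖G u‖ - σ / 2)) ≤ σ ^ 2 / 16 := by
        nlinarith [sq_nonneg (‖G u‖ - σ / 4)]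
      have h6 := mul_le_mul_of_nonneg_left h5 hs0.le
      have h7 := mul_le_mul_of_nonneg_right hsσ hσ.le
      nlinarith
    · have h5 : σ * (σ / 2) ≤ ‖G u‖ * (‖G u‖ - σ / 2) := by
        apply mul_le_mul hge <;> linarith
      have h6 := mul_le_mul_of_nonneg_left h5 hs0.le
      nlinarith
  obtain ⟨M, ⟨A, hA, haA, hbA, hAM⟩, hMc⟩ := exists_lt_of_csInf_lt hSne (lt_add_of_pos_right c hθ)
  have hfix : ∀ u, fderiv ℝ J u = 0 → u - s • G u = u := by
    intro u hu
    have : G u = 0 := by ext i; simp [G, hu]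
    simp [this]
  have hmem : c - θ ∈ S := by
    refine ⟨(fun u => u - s • G u) '' A, hA.image _ (by fun_prop), ⟨a, haA, hfix a ha⟩,
      ⟨b, hbA, hfix b hb⟩, ?_⟩
    rintro _ ⟨u, hu, rfl⟩
    exact deform u ((hAM u hu).trans hMc.le)
  linarith [csInf_le hSbdd hmem]

/-- A coercive continuously differentiable function on `ℝ^ι` that is at least `ρ` on the level set
`{Φ = r}` and takes values below `ρ` on both sides of it has three distinct critical points. -/
theorem exists_three_critical_points {ι : Type*} [Fintype ι] {J Φ : (ι → ℝ) → ℝ}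
    (hJ : ContDiff ℝ 1 J) (hco : Tendsto J (cocompact (ι → ℝ)) atTop) (hΦ : Continuous Φ)
    {r ρ : ℝ} (hρ : ∀ u, Φ u = r → ρ ≤ J u) {a b : ι → ℝ} (ha : Φ a < r) (hb : r < Φ b)
    (hJa : J a < ρ) (hJb : J b < ρ) :
    ∃ u₁ u₂ u₃ : ι → ℝ, fderiv ℝ J u₁ = 0 ∧ fderiv ℝ J u₂ = 0 ∧ fderiv ℝ J u₃ = 0 ∧
      u₁ ≠ u₂ ∧ u₁ ≠ u₃ ∧ u₂ ≠ u₃ := by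
  have hmin : ∀ s : Set (ι → ℝ), IsClosed s → ∀ v ∈ s, ∃ u ∈ s, IsMinOn J s u := fun s hs v hv =>
    hJ.continuous.continuousOn.exists_isMinOn' hs hv
      ((hco.eventually_ge_atTop (J v)).filter_mono inf_le_left)
  obtain ⟨u₁, hu₁, hm₁⟩ := hmin {u | Φ u ≤ r} (isClosed_le hΦ continuous_const) a ha.le
  obtain ⟨u₂, hu₂, hm₂⟩ := hmin {u | r ≤ Φ u} (isClosed_le continuous_const hΦ) b hb.le
  have hJ₁ : J u₁ < ρ := (hm₁ (show a ∈ {u | Φ u ≤ r} from ha.le)).trans_lt hJa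
  have hJ₂ : J u₂ < ρ := (hm₂ (show b ∈ {u | r ≤ Φ u} from hb.le)).trans_lt hJb
  have hΦ₁ : Φ u₁ < r := lt_of_le_of_ne hu₁ fun he => (hρ _ he).not_gt hJ₁
  have hΦ₂ : r < Φ u₂ := lt_of_le_of_ne hu₂ fun he => (hρ _ he.symm).not_gt hJ₂
  have hc₁ : fderiv ℝ J u₁ = 0 := (hm₁.isLocalMin (mem_of_superset
    ((isOpen_lt hΦ continuous_const).mem_nhds hΦ₁) fun u hu => (show Φ u < r from hu).le)).fderiv_eq_zero
  have hc₂ : fderiv ℝ J u₂ = 0 := (hm₂.isLocalMin (mem_of_superset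
    ((isOpen_lt continuous_const hΦ).mem_nhds hΦ₂) fun u hu => (show r < Φ u from hu).le)).fderiv_eq_zero
  obtain ⟨u₃, hc₃, hJ₃⟩ := exists_mountain_pass hJ hco hc₁ hc₂ (ρ := ρ) fun A hA h₁ h₂ => by
    obtain ⟨u, hu, hur⟩ := hA.intermediate_value h₁ h₂ hΦ.continuousOn ⟨hΦ₁.le, hΦ₂.le⟩
    exact ⟨u, hu, hρ u hur⟩
  refine ⟨u₁, u₂, u₃, hc₁, hc₂, hc₃, ?_, ?_, ?_⟩
  · rintro rfl; linarith
  · rintro rfl; linarith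
  · rintro rfl; linarith

theorem exists_sub_le_mul_rpow_sub_mul_rpow {a α p : ℝ} (ha : 0 < a) (hα : 0 ≤ α) (hαp : α < p)
    (hp : 1 < p) (b : ℝ) : ∃ C, ∀ t, 0 ≤ t → t - C ≤ a * t ^ p - b * t ^ α := by
  have small : ∀ (b β : ℝ), β < p → ∀ᶠ t : ℝ in atTop, b * t ^ β ≤ a / 2 * t ^ p := by
    intro b β hβ
    have h1 := (tendsto_rpow_neg_atTop (sub_pos.2 hβ)).const_mul b
    rw [mul_zero] at h1
    filter_upwards [h1.eventually_le_const (half_pos ha), eventually_gt_atTop 0] with t ht h0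
    calc b * t ^ β = b * t ^ (-(p - β)) * t ^ p := by
          rw [mul_assoc, ← Real.rpow_add h0]; ring_nf
      _ ≤ a / 2 * t ^ p := by gcongr
  obtain ⟨T, hT⟩ := eventually_atTop.1 ((small b α hαp).and (small 1 1 hp))
  have hcont : Continuous fun t : ℝ => t - (a * t ^ p - b * t ^ α) := by
    have h1 := Real.continuous_rpow_const (q := p) (by linarith)
    have h2 := Real.continuous_rpow_const hα
    fun_prop
  obtain ⟨C, hC⟩ := (isCompact_Icc (a := (0 : ℝ)) (b := T)).bddAbove_image hcont.continuousOn
  refine ⟨max C 0, fun t ht => ?_⟩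
  rcases le_total t T with h | h
  · have : t - (a * t ^ p - b * t ^ α) ≤ C := hC ⟨t, ⟨ht, h⟩, rfl⟩
    linarith [le_max_left C 0]
  · obtain ⟨h1, h2⟩ := hT t h
    rw [Real.rpow_one] at h2
    linarith [le_max_right C 0]

theorem tendsto_cocompact_atTop_of_sum_abs_le {ι : Type*} [Fintype ι] {J : (ι → ℝ) → ℝ}
    {c : ι → ℝ} (hc : ∀ i, 0 < c i) (C : ℝ) (hJ : ∀ u, ∑ i, c i * |u i| - C ≤ J u) :
    Tendsto J (cocompact (ι → ℝ)) atTop := by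
  obtain ⟨d, hd, hdc⟩ : ∃ d > 0, ∀ i, d ≤ c i := by
    obtain ⟨d, hd⟩ := (Set.finite_range fun i => (c i)⁻¹).bddAbove
    refine ⟨(max d 1)⁻¹, by positivity, fun i => ?_⟩
    rw [inv_le_comm₀ (by positivity) (hc i)]
    exact (hd ⟨i, rfl⟩).trans (le_max_left _ _)
  refine tendsto_atTop_mono (f := fun u => d * ‖u‖ - C) (fun u => le_trans ?_ (hJ u)) ?_
  · gcongr
    have hsum : 0 ≤ ∑ i, c i * |u i| :=
      Finset.sum_nonneg fun i _ => mul_nonneg (hc i).le (abs_nonneg _)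
    rw [mul_comm, ← le_div_iff₀ hd, pi_norm_le_iff_of_nonneg (by positivity)]
    intro i
    rw [le_div_iff₀ hd, mul_comm, Real.norm_eq_abs]
    calc d * |u i| ≤ c i * |u i| := by gcongr; exact hdc i
      _ ≤ _ := Finset.single_le_sum (f := fun i => c i * |u i|)
        (fun i _ => mul_nonneg (hc i).le (abs_nonneg _)) (Finset.mem_univ i)
  · exact tendsto_atTop_add_const_right _ _ ((tendsto_norm_cocompact_atTop (E := ι → ℝ)).const_mul_atTop hd)

noncomputable section

variable {V : Type*} [Fintype V]

/-- The graph Laplacian as a linear map. -/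
def glapLin (w : V → V → ℝ) (μ : V → ℝ) : (V → ℝ) →ₗ[ℝ] (V → ℝ) where
  toFun := glap w μ
  map_add' u v := by
    ext x
    simp only [glap, Pi.add_apply, ← mul_add, ← Finset.sum_add_distrib]
    congr 1
    exact Finset.sum_congr rfl fun y _ => by ring
  map_smul' c u := by
    ext x
    simp only [glap, Pi.smul_apply, smul_eq_mul, RingHom.id_apply, Finset.mul_sum]
    exact Finset.sum_congr rfl fun y _ => by ring

theorem glap_iterate_eq (w : V → V → ℝ) (μ : V → ℝ) (k : ℕ) :
    (glap w μ)^[k] = ⇑(glapLin w μ ^ k) := by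
  ext u x
  rw [Module.End.pow_apply]
  rfl

theorem glap_const (w : V → V → ℝ) (μ : V → ℝ) (c : ℝ) :
    glap w μ (fun _ => c) = fun _ => 0 := by
  ext x
  simp [glap]

theorem exists_glap_iterate_const (w : V → V → ℝ) (μ : V → ℝ) (k : ℕ) (c : ℝ) :
    ∃ d, (glap w μ)^[k] (fun _ => c) = fun _ => d := by
  induction k with
  | zero => exact ⟨c, rfl⟩
  | succ k ih =>
    obtain ⟨d, hd⟩ := ih
    exact ⟨0, by rw [Function.iterate_succ_apply', hd, glap_const]⟩

/-- The symmetric bilinear form whose diagonal is `|∇^m u|²`. -/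
def gradForm (w : V → V → ℝ) (μ : V → ℝ) (m : ℕ) (u v : V → ℝ) (x : V) : ℝ :=
  if m % 2 = 1 then ggam w μ ((glap w μ)^[(m - 1) / 2] u) ((glap w μ)^[(m - 1) / 2] v) x
  else (glap w μ)^[m / 2] u x * (glap w μ)^[m / 2] v x

theorem gradm_eq_sqrt (w : V → V → ℝ) (μ : V → ℝ) (m : ℕ) (u : V → ℝ) (x : V) :
    gradm w μ m u x = √(gradForm w μ m u u x) := by
  unfold gradm gradForm
  split_ifs
  · rfl
  · rw [Real.sqrt_mul_self_eq_abs]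

theorem Bmp_eq (w : V → V → ℝ) (μ : V → ℝ) (m : ℕ) (p : ℝ) (u φ : V → ℝ) :
    Bmp w μ m p u φ = intV μ fun x => gradm w μ m u x ^ (p - 2) * gradForm w μ m u φ x := by
  unfold Bmp gradForm
  split_ifs
  · rfl
  · simp only [mul_assoc]

theorem gradForm_self_nonneg {w : V → V → ℝ} {μ : V → ℝ} (hw : ∀ x y, 0 ≤ w x y)
    (hμ : ∀ x, 0 < μ x) (m : ℕ) (u : V → ℝ) (x : V) : 0 ≤ gradForm w μ m u u x := by
  unfold gradForm
  split_ifs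
  · refine mul_nonneg (by have := hμ x; positivity) (Finset.sum_nonneg fun y _ => ?_)
    rw [mul_assoc]
    exact mul_nonneg (hw x y) (mul_self_nonneg _)
  · exact mul_self_nonneg _

theorem gradForm_add_smul (w : V → V → ℝ) (μ : V → ℝ) (m : ℕ) (u φ : V → ℝ) (t : ℝ) (x : V) :
    gradForm w μ m (u + t • φ) (u + t • φ) x =
      gradForm w μ m u u x + t * (2 * gradForm w μ m u φ x) + t ^ 2 * gradForm w μ m φ φ x := by
  unfold gradForm
  simp only [glap_iterate_eq, map_add, map_smul]
  split_ifs
  · simp only [ggam, Finset.mul_sum, ← Finset.sum_add_distrib, Pi.add_apply, Pi.smul_apply,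
      smul_eq_mul]
    exact Finset.sum_congr rfl fun y _ => by ring
  · simp only [Pi.add_apply, Pi.smul_apply, smul_eq_mul]
    ring

theorem contDiff_gradForm_self (w : V → V → ℝ) (μ : V → ℝ) (m : ℕ) (x : V) {n : ℕ∞} :
    ContDiff ℝ n fun u => gradForm w μ m u u x := by
  have hL : ∀ (k : ℕ) (y : V), ContDiff ℝ n fun u => (glap w μ)^[k] u y := by
    intro k y
    rw [glap_iterate_eq]
    exact (contDiff_apply ℝ ℝ y).comp
      (LinearMap.toContinuousLinearMap (glapLin w μ ^ k)).contDiff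
  unfold gradForm ggam
  split_ifs
  · exact contDiff_const.mul (ContDiff.sum fun y _ =>
      (contDiff_const.mul ((hL _ y).sub (hL _ x))).mul ((hL _ y).sub (hL _ x)))
  · exact (hL _ x).mul (hL _ x)

theorem gradm_const (w : V → V → ℝ) (μ : V → ℝ) {m : ℕ} (hm : 1 ≤ m) (c : ℝ) (x : V) :
    gradm w μ m (fun _ => c) x = 0 := by
  unfold gradm
  split_ifs with hpar
  · obtain ⟨d, hd⟩ := exists_glap_iterate_const w μ ((m - 1) / 2) c
    simp [hd, gnorm, ggam]
  · obtain ⟨k, hk⟩ : ∃ k, m / 2 = k + 1 := ⟨m / 2 - 1, by omega⟩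
    obtain ⟨d, hd⟩ := exists_glap_iterate_const w μ k c
    rw [hk, Function.iterate_succ_apply', hd, glap_const, abs_zero]

theorem gradm_nonneg (w : V → V → ℝ) (μ : V → ℝ) (m : ℕ) (u : V → ℝ) (x : V) :
    0 ≤ gradm w μ m u x := by
  rw [gradm_eq_sqrt]
  exact Real.sqrt_nonneg _

theorem gradm_rpow_eq {w : V → V → ℝ} {μ : V → ℝ} (hw : ∀ x y, 0 ≤ w x y)
    (hμ : ∀ x, 0 < μ x) (m : ℕ) (q : ℝ) (u : V → ℝ) (x : V) :
    gradm w μ m u x ^ q = gradForm w μ m u u x ^ (q / 2) := by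
  rw [gradm_eq_sqrt, Real.sqrt_eq_rpow, ← Real.rpow_mul (gradForm_self_nonneg hw hμ m u x)]
  ring_nf

theorem contDiff_gradm_rpow {w : V → V → ℝ} {μ : V → ℝ} (hw : ∀ x y, 0 ≤ w x y)
    (hμ : ∀ x, 0 < μ x) (m : ℕ) {p : ℝ} (hp : 2 ≤ p) (x : V) :
    ContDiff ℝ 1 fun u => gradm w μ m u x ^ p := by
  simp_rw [gradm_rpow_eq hw hμ]
  exact (Real.contDiff_rpow_const_of_le (n := 1) (p := p / 2) (by push_cast; linarith)).comp
    (contDiff_gradForm_self w μ m x)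

theorem hasDerivAt_gradm_rpow {w : V → V → ℝ} {μ : V → ℝ} (hw : ∀ x y, 0 ≤ w x y)
    (hμ : ∀ x, 0 < μ x) (m : ℕ) {p : ℝ} (hp : 2 ≤ p) (u φ : V → ℝ) (x : V) :
    HasDerivAt (fun t : ℝ => gradm w μ m (u + t • φ) x ^ p)
      (p * (gradm w μ m u x ^ (p - 2) * gradForm w μ m u φ x)) 0 := by
  simp_rw [gradm_rpow_eq hw hμ, gradForm_add_smul]
  have h1 : HasDerivAt (fun t : ℝ => gradForm w μ m u u x + t * (2 * gradForm w μ m u φ x) +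
      t ^ 2 * gradForm w μ m φ φ x) (2 * gradForm w μ m u φ x) 0 := by
    have := (((hasDerivAt_id (0 : ℝ)).mul_const (2 * gradForm w μ m u φ x)).const_add
      (gradForm w μ m u u x)).add (((hasDerivAt_id (0 : ℝ)).pow 2).mul_const
        (gradForm w μ m φ φ x))
    convert! this using 1
    simp
  convert! h1.rpow_const (p := p / 2) (Or.inr (by linarith)) using 1
  rw [show (p - 2) / 2 = p / 2 - 1 by ring]
  simp
  ring

/-- The energy `(1/p) ‖u‖_{W^{m,p}}^p`. -/
def sobolevEnergy (w : V → V → ℝ) (μ h : V → ℝ) (m : ℕ) (p : ℝ) (u : V → ℝ) : ℝ :=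
  (1 / p) * intV μ fun x => gradm w μ m u x ^ p + h x * |u x| ^ p

theorem contDiff_sobolevEnergy {w : V → V → ℝ} {μ : V → ℝ} (hw : ∀ x y, 0 ≤ w x y)
    (hμ : ∀ x, 0 < μ x) (h : V → ℝ) (m : ℕ) {p : ℝ} (hp : 2 ≤ p) :
    ContDiff ℝ 1 (sobolevEnergy w μ h m p) := by
  refine contDiff_const.mul (ContDiff.sum fun x _ => contDiff_const.mul
    ((contDiff_gradm_rpow hw hμ m hp x).add (contDiff_const.mul ?_)))
  exact (contDiff_norm_rpow (E := ℝ) (by linarith)).comp (contDiff_apply ℝ ℝ x)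

theorem hasDerivAt_sobolevEnergy {w : V → V → ℝ} {μ : V → ℝ} (hw : ∀ x y, 0 ≤ w x y)
    (hμ : ∀ x, 0 < μ x) (h : V → ℝ) (m : ℕ) {p : ℝ} (hp : 2 ≤ p) (u φ : V → ℝ) :
    HasDerivAt (fun t : ℝ => sobolevEnergy w μ h m p (u + t • φ))
      (Bmp w μ m p u φ + intV μ fun x => h x * |u x| ^ (p - 2) * u x * φ x) 0 := by
  have hterm : ∀ x, HasDerivAt (fun t : ℝ => μ x * (gradm w μ m (u + t • φ) x ^ p +
      h x * |(u + t • φ) x| ^ p)) (μ x * (p * (gradm w μ m u x ^ (p - 2) * gradForm w μ m u φ x) +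
        h x * (p * |u x| ^ (p - 2) * u x * φ x))) 0 := by
    intro x
    refine ((hasDerivAt_gradm_rpow hw hμ m hp u φ x).add (HasDerivAt.const_mul _ ?_)).const_mul _
    have h1 : HasDerivAt (fun t : ℝ => (u + t • φ) x) (φ x) 0 := by
      simpa using ((hasDerivAt_id (0 : ℝ)).mul_const (φ x)).const_add (u x)
    have h2 := hasDerivAt_abs_rpow ((u + (0 : ℝ) • φ) x) (p := p) (by linarith)
    simpa [Function.comp_def] using h2.comp (0 : ℝ) h1
  have := (HasDerivAt.fun_sum fun x (_ : x ∈ Finset.univ) => hterm x).const_mul (1 / p)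
  convert! this using 1
  rw [Bmp_eq]
  simp only [intV, Finset.mul_sum, ← Finset.sum_add_distrib]
  have hp0 : p ≠ 0 := by linarith
  exact Finset.sum_congr rfl fun x _ => by field_simp

theorem mul_abs_rpow_le_sobolevEnergy {w : V → V → ℝ} {μ : V → ℝ} (hμ : ∀ x, 0 < μ x)
    {h : V → ℝ} (hh : ∀ x, 0 < h x) (m : ℕ) {p : ℝ} (hp : 0 < p) (u : V → ℝ) (x : V) :
    μ x * (h x * |u x| ^ p) ≤ p * sobolevEnergy w μ h m p u := by
  have hgrad : ∀ y, 0 ≤ gradm w μ m u y ^ p := fun y =>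
    Real.rpow_nonneg (gradm_nonneg w μ m u y) p
  have hpot : ∀ y, 0 ≤ h y * |u y| ^ p := fun y =>
    mul_nonneg (hh y).le (Real.rpow_nonneg (abs_nonneg _) p)
  calc μ x * (h x * |u x| ^ p) ≤ μ x * (gradm w μ m u x ^ p + h x * |u x| ^ p) := by
        have := hμ x
        gcongr
        linarith [hgrad x]
    _ ≤ intV μ fun x => gradm w μ m u x ^ p + h x * |u x| ^ p :=
        Finset.single_le_sum (f := fun y => μ y * (gradm w μ m u y ^ p + h y * |u y| ^ p))
          (fun y _ => mul_nonneg (hμ y).le (add_nonneg (hgrad y) (hpot y))) (Finset.mem_univ x)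
    _ = p * sobolevEnergy w μ h m p u := by
        unfold sobolevEnergy
        field_simp

theorem sum_mul_abs_rpow_le_sobolevEnergy (w : V → V → ℝ) {μ : V → ℝ} (hμ : ∀ x, 0 < μ x)
    (h : V → ℝ) (m : ℕ) {p : ℝ} (hp : 0 < p) (u : V → ℝ) :
    ∑ x, μ x * (h x / p * |u x| ^ p) ≤ sobolevEnergy w μ h m p u := by
  unfold sobolevEnergy intV
  rw [Finset.mul_sum]
  refine Finset.sum_le_sum fun x _ => ?_
  have h1 := mul_nonneg (hμ x).le (Real.rpow_nonneg (gradm_nonneg w μ m u x) p)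
  have h2 : 0 ≤ 1 / p := by positivity
  calc μ x * (h x / p * |u x| ^ p) = 1 / p * (μ x * (h x * |u x| ^ p)) := by ring
    _ ≤ 1 / p * (μ x * (gradm w μ m u x ^ p + h x * |u x| ^ p)) := by
        exact mul_le_mul_of_nonneg_left (by linarith) h2

theorem abs_le_of_sobolevEnergy_le [Nonempty V] {w : V → V → ℝ} {μ : V → ℝ} (hμ : ∀ x, 0 < μ x)
    {h : V → ℝ} (hh : ∀ x, 0 < h x) (m : ℕ) {p : ℝ} (hp : 0 < p) {r : ℝ} {u : V → ℝ}
    (hu : sobolevEnergy w μ h m p u ≤ r) (x : V) :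
    |u x| ≤ (p * r) ^ (1 / p) / (fmin h ^ (1 / p) * fmin μ ^ (1 / p)) := by
  have hfmin : ∀ g : V → ℝ, (∀ y, 0 < g y) → 0 < fmin g ∧ ∀ y, fmin g ≤ g y := fun g hg =>
    ⟨(Finset.lt_inf'_iff _).2 fun y _ => hg y, fun y => Finset.inf'_le _ (Finset.mem_univ y)⟩
  obtain ⟨hh0, hhx⟩ := hfmin h hh
  obtain ⟨hμ0, hμx⟩ := hfmin μ hμ
  have hup : 0 ≤ |u x| ^ p := Real.rpow_nonneg (abs_nonneg _) p
  have key : |u x| ^ p ≤ p * r / (fmin h * fmin μ) := by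
    rw [le_div_iff₀ (mul_pos hh0 hμ0)]
    calc |u x| ^ p * (fmin h * fmin μ) ≤ |u x| ^ p * (h x * μ x) := by
          gcongr
          · exact (hh x).le
          · exact hhx x
          · exact hμx x
      _ = μ x * (h x * |u x| ^ p) := by ring
      _ ≤ p * sobolevEnergy w μ h m p u := mul_abs_rpow_le_sobolevEnergy hμ hh m hp u x
      _ ≤ p * r := by gcongr
  have hpr : 0 ≤ p * r := by
    have := hup.trans key
    rw [le_div_iff₀ (mul_pos hh0 hμ0)] at this
    linarith
  rw [← Real.mul_rpow hh0.le hμ0.le, ← Real.div_rpow hpr (mul_pos hh0 hμ0).le]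
  calc |u x| = (|u x| ^ p) ^ (1 / p) := by
        rw [← Real.rpow_mul (abs_nonneg _), mul_one_div_cancel hp.ne', Real.rpow_one]
    _ ≤ _ := Real.rpow_le_rpow hup key (by positivity)

theorem sobolevEnergy_const (w : V → V → ℝ) (μ h : V → ℝ) {m : ℕ} (hm : 1 ≤ m) {p : ℝ}
    (hp : 0 < p) {c : ℝ} (hc : 0 ≤ c) :
    sobolevEnergy w μ h m p (fun _ => c) = c ^ p / p * intV μ h := by
  simp only [sobolevEnergy, intV, gradm_const w μ hm, Real.zero_rpow hp.ne', zero_add,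
    abs_of_nonneg hc, Finset.mul_sum]
  exact Finset.sum_congr rfl fun x _ => by ring

end

end

/-- Theorem 5.1: three distinct solutions for the scalar poly-Laplacian equation on a
finite graph. -/
theorem stmt2 {V : Type*} [Fintype V] [Nonempty V]
    (w : V → V → ℝ) (μ : V → ℝ)
    (hw_symm : ∀ x y, w x y = w y x) (hw_nonneg : ∀ x y, 0 ≤ w x y)
    (hw_diag : ∀ x, w x x = 0) (hμ : ∀ x, 0 < μ x)
    (m : ℕ) (hm : 1 ≤ m) (p : ℝ) (hp : 2 ≤ p)
    (h : V → ℝ) (hh : ∀ x, 0 < h x)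
    (f : V → ℝ → ℝ) (hf : ∀ x, Continuous (f x))
    (F : V → ℝ → ℝ) (hF : ∀ x s, F x s = ∫ τ in (0:ℝ)..s, f x τ)
    -- (f2)
    (α : ℝ) (hα0 : 0 ≤ α) (hαp : α < p)
    (g1 g2 : V → ℝ)
    (hf2 : ∀ x s, F x s ≤ g1 x * |s| ^ α + g2 x)
    -- (f3)
    (γ δ : ℝ) (hγ : 0 < γ) (hδ : 0 < δ)
    (hδκ : δ > γ * ((1 / p) * intV μ h) ^ (-(1 / p)))
    (Λ1 Λ2 : ℝ)
    (hΛ1 : Λ1 = γ ^ (-p) *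
        sSup {z : ℝ | ∃ x : V, ∃ s : ℝ,
          |s| ≤ (p * γ ^ p) ^ (1 / p) / ((fmin h) ^ (1 / p) * (fmin μ) ^ (1 / p)) ∧
          z = F x s} * (∑ x, μ x))
    (hΛ2 : Λ2 = fmin (fun x => F x δ) * (∑ x, μ x) / ((δ ^ p / p) * intV μ h))
    (hf3 : Λ1 < Λ2)
    (lam : ℝ) (hlam : 0 < lam) (hlamΛ2 : 1 < lam * Λ2) (hlamΛ1 : lam * Λ1 < 1) :
    ∃ u1 u2 u3 : V → ℝ,
      isSolScalar w μ h m p lam f u1 ∧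
      isSolScalar w μ h m p lam f u2 ∧
      isSolScalar w μ h m p lam f u3 ∧
      u1 ≠ u2 ∧ u1 ≠ u3 ∧ u2 ≠ u3 := by
  have hp0 : 0 < p := by linarith
  have hFd : ∀ x s, HasDerivAt (F x) (f x s) s := by
    intro x s
    rw [show F x = fun s => ∫ τ in (0:ℝ)..s, f x τ from funext (hF x)]
    exact ((hf x).integral_hasStrictDerivAt 0 s).hasDerivAt
  have hF0 : ∀ x, F x 0 = 0 := fun x => by rw [hF, intervalIntegral.integral_same]
  have hFc : ∀ x, ContDiff ℝ 1 (F x) := fun x => contDiff_one_iff_deriv.2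
    ⟨fun s => (hFd x s).differentiableAt, by
      rw [show deriv (F x) = f x from funext fun s => (hFd x s).deriv]; exact hf x⟩
  have hIh : 0 < intV μ h :=
    Finset.sum_pos (fun x _ => mul_pos (hμ x) (hh x)) Finset.univ_nonempty
  have hγp : 0 < γ ^ p := Real.rpow_pos_of_pos hγ p
  let Φ : (V → ℝ) → ℝ := sobolevEnergy w μ h m p
  let J : (V → ℝ) → ℝ := fun u => Φ u - lam * intV μ fun x => F x (u x)
  have hΦc : ContDiff ℝ 1 Φ := contDiff_sobolevEnergy hw_nonneg hμ h m hp
  have hJc : ContDiff ℝ 1 J := hΦc.sub (contDiff_const.mul (ContDiff.sum fun x _ =>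
    contDiff_const.mul ((hFc x).comp (contDiff_apply ℝ ℝ x))))
  have hsol : ∀ u, fderiv ℝ J u = 0 → isSolScalar w μ h m p lam f u := by
    intro u hu φ
    have hline : HasDerivAt (fun t : ℝ => u + t • φ) φ 0 := by
      simpa using ((hasDerivAt_id (0 : ℝ)).smul_const φ).const_add u
    have hfd : HasFDerivAt J (0 : (V → ℝ) →L[ℝ] ℝ) (u + (0 : ℝ) • φ) := by
      rw [zero_smul, add_zero, ← hu]
      exact (hJc.differentiable one_ne_zero u).hasFDerivAt
    have h1 := hfd.comp_hasDerivAt (0 : ℝ) hline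
    have hterm : ∀ x, HasDerivAt (fun t : ℝ => μ x * F x ((u + t • φ) x))
        (μ x * (f x (u x) * φ x)) 0 := by
      intro x
      have h3 : HasDerivAt (fun t : ℝ => (u + t • φ) x) (φ x) 0 := hasDerivAt_pi.1 hline x
      have h4 := (hFd x ((u + (0 : ℝ) • φ) x)).comp (0 : ℝ) h3
      simpa [Function.comp_def] using h4.const_mul (μ x)
    have h2 := (hasDerivAt_sobolevEnergy hw_nonneg hμ h m hp u φ).sub
      ((HasDerivAt.fun_sum fun x (_ : x ∈ Finset.univ) => hterm x).const_mul lam)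
    have h5 := h1.unique h2
    rw [zero_apply] at h5
    exact sub_eq_zero.1 h5.symm
  have hco : Filter.Tendsto J (Filter.cocompact (V → ℝ)) Filter.atTop := by
    choose C hC using fun x => exists_sub_le_mul_rpow_sub_mul_rpow (div_pos (hh x) hp0) hα0 hαp
      (by linarith) (lam * g1 x)
    refine tendsto_cocompact_atTop_of_sum_abs_le hμ (∑ x, μ x * (C x + lam * g2 x)) fun u => ?_
    refine le_trans ?_ (sub_le_sub_right
      (sum_mul_abs_rpow_le_sobolevEnergy w hμ h m hp0 u) _)
    unfold intV
    rw [Finset.mul_sum, ← Finset.sum_sub_distrib, ← Finset.sum_sub_distrib]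
    refine Finset.sum_le_sum fun x _ => ?_
    have h1 := hC x |u x| (abs_nonneg _)
    have h2 := mul_le_mul_of_nonneg_left (hf2 x (u x)) hlam.le
    have h3 : |u x| - C x - lam * g2 x ≤ h x / p * |u x| ^ p - lam * F x (u x) := by linarith
    linarith [mul_le_mul_of_nonneg_left h3 (hμ x).le]
  have hlevel : ∀ u, Φ u = γ ^ p → γ ^ p * (1 - lam * Λ1) ≤ J u := by
    intro u hu
    set R := (p * γ ^ p) ^ (1 / p) / ((fmin h) ^ (1 / p) * (fmin μ) ^ (1 / p))
    set Z := {z : ℝ | ∃ x : V, ∃ s : ℝ, |s| ≤ R ∧ z = F x s}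
    have hbdd : BddAbove Z := by
      choose B hB using fun x => (isCompact_Icc (a := -R) (b := R)).bddAbove_image
        (hFc x).continuous.continuousOn
      refine ⟨Finset.univ.sup' Finset.univ_nonempty B, ?_⟩
      rintro _ ⟨x, s, hs, rfl⟩
      exact (hB x ⟨s, abs_le.1 hs, rfl⟩).trans (Finset.le_sup' B (Finset.mem_univ x))
    have hsup : ∀ x, F x (u x) ≤ sSup Z := fun x => le_csSup hbdd
      ⟨x, u x, abs_le_of_sobolevEnergy_le hμ hh m hp0 hu.le x, rfl⟩
    have hint : (intV μ fun x => F x (u x)) ≤ γ ^ p * Λ1 := by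
      calc (intV μ fun x => F x (u x)) ≤ ∑ x, μ x * sSup Z :=
            Finset.sum_le_sum fun x _ => mul_le_mul_of_nonneg_left (hsup x) (hμ x).le
        _ = γ ^ p * Λ1 := by
            rw [hΛ1, ← Finset.sum_mul, Real.rpow_neg hγ.le]
            field_simp
    have := mul_le_mul_of_nonneg_left hint hlam.le
    change _ ≤ Φ u - _
    rw [hu]
    linarith
  have hρ : 0 < γ ^ p * (1 - lam * Λ1) := mul_pos hγp (by linarith)
  have hΦ0 : Φ (fun _ => 0) = 0 := by
    change sobolevEnergy w μ h m p _ = 0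
    rw [sobolevEnergy_const w μ h hm hp0 le_rfl, Real.zero_rpow hp0.ne']
    simp
  have hΦδ : Φ (fun _ => δ) = δ ^ p / p * intV μ h := sobolevEnergy_const w μ h hm hp0 hδ.le
  have hΦδpos : 0 < δ ^ p / p * intV μ h := by positivity
  have hγδ : γ ^ p < δ ^ p / p * intV μ h := by
    have hI : 0 < 1 / p * intV μ h := by positivity
    have h1 := Real.rpow_lt_rpow (by positivity) hδκ hp0
    rw [Real.mul_rpow hγ.le (by positivity), ← Real.rpow_mul hI.le,
      show -(1 / p) * p = -1 by field_simp, Real.rpow_neg_one, ← div_eq_mul_inv,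
      div_lt_iff₀ hI] at h1
    calc γ ^ p < _ := h1
      _ = _ := by ring
  have hJ0 : J (fun _ => 0) < γ ^ p * (1 - lam * Λ1) := by
    simpa only [J, hΦ0, hF0, intV, mul_zero, Finset.sum_const_zero, sub_zero] using hρ
  have hJδ : J (fun _ => δ) < γ ^ p * (1 - lam * Λ1) := by
    refine lt_trans ?_ hρ
    have h1 : δ ^ p / p * intV μ h * Λ2 ≤ intV μ fun x => F x δ := by
      calc δ ^ p / p * intV μ h * Λ2 = ∑ x, μ x * fmin fun x => F x δ := by
            rw [hΛ2, ← Finset.sum_mul, mul_div_cancel₀ _ hΦδpos.ne', mul_comm]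
        _ ≤ _ := Finset.sum_le_sum fun x _ => mul_le_mul_of_nonneg_left
            (Finset.inf'_le _ (Finset.mem_univ x)) (hμ x).le
    have h2 := mul_le_mul_of_nonneg_left h1 hlam.le
    have h3 := mul_lt_mul_of_pos_left hlamΛ2 hΦδpos
    change Φ _ - _ < 0
    rw [hΦδ]
    linarith
  obtain ⟨u₁, u₂, u₃, h₁, h₂, h₃, hne⟩ := exists_three_critical_points hJc hco hΦc.continuous
    hlevel (hΦ0.trans_lt hγp) (hγδ.trans_eq hΦδ.symm) hJ0 hJδ
  exact ⟨u₁, u₂, u₃, hsol u₁ h₁, hsol u₂ h₂, hsol u₃ h₃, hne⟩
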